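/- Let d ≥ 1 and let μ, ν be Borel probability measures on ℝ^d with finite second moments. Then μ ⪯_c ν (μ and ν are in convex order) if and only if for every Borel probability measure ρ on ℝ^d whose support is contained in the closed unit ball B₁(0), one has W₂(ν,ρ)² − W₂(μ,ρ)² ≤ ∫ ‖y‖² ν(dy) − ∫ ‖x‖² μ(dx). -/

import Mathlib

open MeasureTheory
open scoped RealInnerProductSpace

noncomputable section

abbrev Euc (d : ℕ) : Type := EuclideanSpace ℝ (Fin d)

/-- `π` is a coupling of `μ` and `ν`. -/
def IsCoupling {d : ℕ} (μ ν : Measure (Euc d)) (π : Measure (Euc d × Euc d)) : Prop :=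
  IsProbabilityMeasure π ∧ π.map Prod.fst = μ ∧ π.map Prod.snd = ν

/-- The squared 2-Wasserstein distance: infimum over couplings of `∫ ‖x - y‖²`. -/
def W2sq {d : ℕ} (μ ν : Measure (Euc d)) : ℝ :=
  sInf { r : ℝ | ∃ π : Measure (Euc d × Euc d), IsCoupling μ ν π ∧
    r = ∫ p, ‖p.1 - p.2‖ ^ 2 ∂π }

/-- Convex order: `∫ f dμ ≤ ∫ f dν` for every (integrable) convex `f`. -/
def ConvexOrder {d : ℕ} (μ ν : Measure (Euc d)) : Prop :=
  ∀ f : Euc d → ℝ, ConvexOn ℝ Set.univ f → Integrable f μ → Integrable f ν →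
    ∫ x, f x ∂μ ≤ ∫ y, f y ∂ν

lemma exists_measurable_argmax {α ι : Type*} [MeasurableSpace α] {F : ι → α → ℝ}
    (hF : ∀ i, Measurable (F i)) {s : Finset ι} (hs : s.Nonempty) :
    ∃ j : α → ι, (∀ i, MeasurableSet (j ⁻¹' {i})) ∧ Measurable (fun x => F (j x) x) ∧
      ∀ x, j x ∈ s ∧ ∀ i ∈ s, F i x ≤ F (j x) x := by
  classical
  induction hs using Finset.Nonempty.cons_induction with
  | singleton a =>
    exact ⟨fun _ => a, fun i => MeasurableSet.const (a = i), hF a, fun x => by simp⟩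
  | cons a s ha hs ih =>
    obtain ⟨j, hj, hg, hmax⟩ := ih
    have hlt : MeasurableSet {x | F (j x) x < F a x} := measurableSet_lt hg (hF a)
    refine ⟨fun x => if F (j x) x < F a x then a else j x, fun i => ?_, ?_, fun x => ?_⟩
    · have : (fun x => if F (j x) x < F a x then a else j x) ⁻¹' {i} =
          ({x | F (j x) x < F a x} ∩ {_x | a = i}) ∪ ({x | F (j x) x < F a x}ᶜ ∩ j ⁻¹' {i}) := by
        ext x
        by_cases h : F (j x) x < F a x <;> simp [h]
      rw [this]
      exact (hlt.inter (MeasurableSet.const _)).union (hlt.compl.inter (hj i))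
    · have : (fun x => F (if F (j x) x < F a x then a else j x) x) =
          fun x => if F (j x) x < F a x then F a x else F (j x) x := by
        ext x; split_ifs <;> rfl
      rw [this]
      exact Measurable.ite hlt (hF a) hg
    · by_cases h : F (j x) x < F a x
      · simp only [h, if_true, Finset.mem_cons, true_or, true_and, forall_eq_or_imp, le_refl]
        exact fun i hi => ((hmax x).2 i hi).trans h.le
      · simp only [h, if_false, Finset.mem_cons, (hmax x).1, or_true, true_and, forall_eq_or_imp]
        exact ⟨not_lt.1 h, (hmax x).2⟩

lemma integrable_comp_argmax {α ι : Type*} [MeasurableSpace α] {μ : Measure α}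
    {F : ι → α → ℝ} {j : α → ι} {s : Finset ι} (hF : ∀ i, Integrable (F i) μ) (hs : ∀ x, j x ∈ s)
    (hj : Measurable (fun x => F (j x) x)) : Integrable (fun x => F (j x) x) μ := by
  refine (integrable_finsetSum s fun i _ => (hF i).norm).mono' hj.aestronglyMeasurable
    (ae_of_all _ fun x => ?_)
  exact Finset.single_le_sum (f := fun i => ‖F i x‖) (fun i _ => norm_nonneg _) (hs x)

lemma sum_restrict_eq_of_disjoint {α ι : Type*} [MeasurableSpace α] [Fintype ι] {μ : Measure α}
    {A : ι → Set α} (hA : ∀ i, MeasurableSet (A i)) (hd : Pairwise (Function.onFun Disjoint A))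
    (hc : μ (⋃ i, A i)ᶜ = 0) : ∑ i, μ.restrict (A i) = μ := by
  rw [← Measure.sum_fintype, ← Measure.restrict_iUnion hd hA]
  exact Measure.restrict_eq_self_of_ae_mem (by rw [ae_iff]; exact hc)

lemma le_of_sum_eq {α ι : Type*} [MeasurableSpace α] [Fintype ι] {μ : Measure α}
    {κ : ι → Measure α} (hκ : ∑ i, κ i = μ) (i : ι) : κ i ≤ μ := by
  rw [← hκ, ← Measure.sum_fintype]
  exact Measure.le_sum κ i

lemma integral_eq_sum_of_sum_eq {α ι : Type*} [MeasurableSpace α] [Fintype ι] {μ : Measure α}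
    {κ : ι → Measure α} (hκ : ∑ i, κ i = μ) {f : α → ℝ} (hf : Integrable f μ) :
    ∫ x, f x ∂μ = ∑ i, ∫ x, f x ∂κ i := by
  conv_lhs => rw [← hκ]
  exact integral_finsetSum_measure fun i _ => hf.mono_measure (le_of_sum_eq hκ i)

/-- The masses of the pieces of a decomposition, with the pairing against the vectors `a i`. -/
def momentPoint {d : ℕ} {ι : Type*} [Fintype ι] (a : ι → Euc d) (κ : ι → Measure (Euc d)) :
    (ι → ℝ) × ℝ :=
  (fun i => (κ i).real Set.univ, ∑ i, ∫ x, ⟪x, a i⟫ ∂κ i)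

lemma integrable_inner_const {d : ℕ} {μ : Measure (Euc d)} (hμ : Integrable (fun x => x) μ)
    (a : Euc d) : Integrable (fun x : Euc d => ⟪x, a⟫) μ := hμ.inner_const a

lemma decomposition_combination {d : ℕ} {ι : Type*} [Fintype ι] {ν : Measure (Euc d)}
    [IsFiniteMeasure ν] (hν : Integrable (fun x => x) ν) (a : ι → Euc d)
    {θ θ' : ι → Measure (Euc d)} (hθ : ∑ i, θ i = ν) (hθ' : ∑ i, θ' i = ν)
    {s t : ℝ} (hs : 0 ≤ s) (ht : 0 ≤ t) (hst : s + t = 1) :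
    ∃ η : ι → Measure (Euc d), ∑ i, η i = ν ∧
      momentPoint a η = s • momentPoint a θ + t • momentPoint a θ' := by
  refine ⟨fun i => ENNReal.ofReal s • θ i + ENNReal.ofReal t • θ' i, ?_, ?_⟩
  · rw [Finset.sum_add_distrib, ← Finset.smul_sum, ← Finset.smul_sum, hθ, hθ', ← add_smul,
      ← ENNReal.ofReal_add hs ht, hst, ENNReal.ofReal_one, one_smul]
  · have hfin (i) : IsFiniteMeasure (θ i) := isFiniteMeasure_of_le ν (le_of_sum_eq hθ i)
    have hfin' (i) : IsFiniteMeasure (θ' i) := isFiniteMeasure_of_le ν (le_of_sum_eq hθ' i)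
    have hint (i) := (integrable_inner_const hν (a i)).mono_measure (le_of_sum_eq hθ i)
    have hint' (i) := (integrable_inner_const hν (a i)).mono_measure (le_of_sum_eq hθ' i)
    have hE (i) : IsFiniteMeasure (ENNReal.ofReal s • θ i) :=
      Measure.smul_finite _ ENNReal.ofReal_ne_top
    have hE' (i) : IsFiniteMeasure (ENNReal.ofReal t • θ' i) :=
      Measure.smul_finite _ ENNReal.ofReal_ne_top
    ext i
    · simp only [momentPoint, Prod.fst_add, Prod.smul_fst, Pi.add_apply, Pi.smul_apply,
        smul_eq_mul]
      rw [measureReal_add_apply, measureReal_ennreal_smul_apply, measureReal_ennreal_smul_apply,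
        ENNReal.toReal_ofReal hs, ENNReal.toReal_ofReal ht]
    · simp only [momentPoint, Prod.smul_mk, Prod.mk_add_mk, smul_eq_mul, Finset.mul_sum,
        ← Finset.sum_add_distrib]
      refine Finset.sum_congr rfl fun i _ => ?_
      rw [integral_add_measure ((hint i).smul_measure ENNReal.ofReal_ne_top)
        ((hint' i).smul_measure ENNReal.ofReal_ne_top), integral_smul_measure,
        integral_smul_measure, ENNReal.toReal_ofReal hs, ENNReal.toReal_ofReal ht,
        smul_eq_mul, smul_eq_mul]

lemma continuousLinearMap_momentPoint {d : ℕ} {ι : Type*} [Fintype ι] [DecidableEq ι]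
    {ν : Measure (Euc d)}
    [IsFiniteMeasure ν] (hν : Integrable (fun x => x) ν) (a : ι → Euc d)
    {θ : ι → Measure (Euc d)} (hθ : ∑ i, θ i = ν) (f : StrongDual ℝ ((ι → ℝ) × ℝ)) :
    f (momentPoint a θ) =
      ∑ i, ∫ x, (f (Pi.single i 1, 0) + f (0, 1) * ⟪x, a i⟫) ∂θ i := by
  have hfin (i) : IsFiniteMeasure (θ i) := isFiniteMeasure_of_le ν (le_of_sum_eq hθ i)
  have hint (i) := (integrable_inner_const hν (a i)).mono_measure (le_of_sum_eq hθ i)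
  have key (v : ι → ℝ) (r : ℝ) : f (v, r) = ∑ i, v i * f (Pi.single i 1, 0) + r * f (0, 1) := by
    have h1 : (v, r) = ∑ i, v i • ((Pi.single i 1, 0) : (ι → ℝ) × ℝ) + r • ((0, 1) : (ι → ℝ) × ℝ) := by
      ext i
      · simp [Prod.fst_sum, Finset.sum_apply, Pi.single_apply]
      · simp [Prod.snd_sum]
    rw [h1, map_add, map_sum]
    simp only [map_smul, smul_eq_mul]
  rw [momentPoint, key, Finset.sum_mul, ← Finset.sum_add_distrib]
  refine Finset.sum_congr rfl fun i _ => ?_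
  rw [integral_add (integrable_const _) ((hint i).const_mul _), integral_const,
    integral_const_mul, smul_eq_mul, mul_comm (∫ _, _ ∂_)]

lemma ConvexOrder.momentPoint_mem_closure {d : ℕ} {ι : Type*} [Fintype ι] [Nonempty ι]
    {μ ν : Measure (Euc d)} [IsFiniteMeasure μ] [IsFiniteMeasure ν]
    (hμ : Integrable (fun x => x) μ) (hν : Integrable (fun x => x) ν)
    (h : ConvexOrder μ ν) (a : ι → Euc d) {κ : ι → Measure (Euc d)} (hκ : ∑ i, κ i = μ) :
    momentPoint a κ ∈ closure {p | ∃ θ : ι → Measure (Euc d), ∑ i, θ i = ν ∧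
      momentPoint a θ = p} := by
  classical
  set K := {p | ∃ θ : ι → Measure (Euc d), ∑ i, θ i = ν ∧ momentPoint a θ = p}
  have hK : Convex ℝ K := by
    rintro _ ⟨θ, hθ, rfl⟩ _ ⟨θ', hθ', rfl⟩ s t hs ht hst
    exact decomposition_combination hν a hθ hθ' hs ht hst
  by_contra hP
  obtain ⟨f, u, hfu, huf⟩ := geometric_hahn_banach_closed_point hK.closure isClosed_closure hP
  set F : ι → Euc d → ℝ := fun i x => f (Pi.single i 1, 0) + f (0, 1) * ⟪x, a i⟫ with hF
  have hFm (i) : Measurable (F i) := by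
    simp only [hF]; fun_prop
  have hFμ (i) : Integrable (F i) μ :=
    (integrable_const _).add ((integrable_inner_const hμ _).const_mul _)
  have hFν (i) : Integrable (F i) ν :=
    (integrable_const _).add ((integrable_inner_const hν _).const_mul _)
  obtain ⟨j, hj, hg, hmax⟩ := exists_measurable_argmax hFm (Finset.univ_nonempty (α := ι))
  have hgμ := integrable_comp_argmax hFμ (fun x => (hmax x).1) hg
  have hgν := integrable_comp_argmax hFν (fun x => (hmax x).1) hg
  have hconv : ConvexOn ℝ Set.univ (fun x => F (j x) x) := by
    refine ⟨convex_univ, fun x _ y _ s t hs ht hst => ?_⟩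
    set i := j (s • x + t • y)
    have h1 : F i (s • x + t • y) = s * F i x + t * F i y := by
      simp only [hF, inner_add_left, real_inner_smul_left]
      linear_combination -f (Pi.single i 1, 0) * hst
    show F i (s • x + t • y) ≤ s * F (j x) x + t * F (j y) y
    rw [h1]
    have := (hmax x).2 i (Finset.mem_univ _)
    have := (hmax y).2 i (Finset.mem_univ _)
    gcongr
  have hθ : ∑ i, ν.restrict (j ⁻¹' {i}) = ν := by
    refine sum_restrict_eq_of_disjoint hj (fun i k hik => ?_) ?_
    · exact Disjoint.preimage _ (by simpa using hik)
    · convert measure_empty (μ := ν)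
      ext x; simp
  have h1 : f (momentPoint a κ) ≤ ∫ x, F (j x) x ∂μ := by
    rw [continuousLinearMap_momentPoint hμ a hκ, integral_eq_sum_of_sum_eq hκ hgμ]
    refine Finset.sum_le_sum fun i _ => integral_mono ((hFμ i).mono_measure (le_of_sum_eq hκ i))
      (hgμ.mono_measure (le_of_sum_eq hκ i)) fun x => (hmax x).2 i (Finset.mem_univ _)
  have h2 : f (momentPoint a fun i => ν.restrict (j ⁻¹' {i})) = ∫ x, F (j x) x ∂ν := by
    rw [continuousLinearMap_momentPoint hν a hθ, integral_eq_sum_of_sum_eq hθ hgν]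
    refine Finset.sum_congr rfl fun i _ => setIntegral_congr_fun (hj i) fun x hx => ?_
    rw [Set.mem_preimage, Set.mem_singleton_iff] at hx
    simp only [hF, hx]
  have h3 := hfu _ (subset_closure ⟨_, hθ, rfl⟩)
  have h4 := h _ hconv hgμ hgν
  linarith

lemma ConvexOrder.exists_decomposition {d : ℕ} {ι : Type*} [Fintype ι]
    {μ ν : Measure (Euc d)} [IsProbabilityMeasure μ] [IsProbabilityMeasure ν]
    (hμ : Integrable (fun x => x) μ) (hν : Integrable (fun x => x) ν)
    (h : ConvexOrder μ ν) (a : ι → Euc d) {κ : ι → Measure (Euc d)} (hκ : ∑ i, κ i = μ)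
    (hpos : ∀ i, κ i Set.univ ≠ 0) {δ : ℝ} (hδ : 0 < δ) :
    ∃ θ : ι → Measure (Euc d), ∑ i, θ i = ν ∧ (∀ i, θ i Set.univ = κ i Set.univ) ∧
      ∑ i, ∫ x, ⟪x, a i⟫ ∂κ i - δ ≤ ∑ i, ∫ y, ⟪y, a i⟫ ∂θ i := by
  have hne : Nonempty ι := by
    by_contra hι
    rw [not_nonempty_iff] at hι
    simp at hκ
    exact IsProbabilityMeasure.ne_zero μ hκ.symm
  have hfin (i) : IsFiniteMeasure (κ i) := isFiniteMeasure_of_le μ (le_of_sum_eq hκ i)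
  set w : ι → ℝ := fun i => (κ i).real Set.univ with hw
  have hwpos (i) : 0 < w i := ENNReal.toReal_pos (hpos i) (measure_ne_top _ _)
  have sum_real {μ : Measure (Euc d)} [IsProbabilityMeasure μ] {κ : ι → Measure (Euc d)}
      (hκ : ∑ i, κ i = μ) : ∑ i, (κ i).real Set.univ = 1 := by
    have hfin (i) : IsFiniteMeasure (κ i) := isFiniteMeasure_of_le μ (le_of_sum_eq hκ i)
    have := integral_eq_sum_of_sum_eq hκ (integrable_const (1 : ℝ))
    simpa using this.symm
  obtain ⟨i₀, hi₀⟩ := Finite.exists_min w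
  set T := ∑ i, ∫ x, ⟪x, a i⟫ ∂κ i with hT
  set C := ∑ i, |∫ y, ⟪y, a i⟫ ∂ν|
  have hC : 0 ≤ C := Finset.sum_nonneg fun _ _ => abs_nonneg _
  have hD : 0 < 1 + |T| + C := by positivity
  set ε := min (1 / 2) (δ / (1 + |T| + C))
  have hε : 0 < ε := lt_min (by norm_num) (by positivity)
  have hε1 : ε ≤ 1 / 2 := min_le_left _ _
  have hεδ : ε * (1 + |T| + C) ≤ δ := by
    rw [← le_div_iff₀ hD]; exact min_le_right _ _
  set η := ε * min 1 (w i₀)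
  have hη : 0 < η := mul_pos hε (lt_min one_pos (hwpos _))
  have hη1 : η ≤ ε := mul_le_of_le_one_right hε.le (min_le_left _ _)
  have hηw (i) : η ≤ ε * w i :=
    mul_le_mul_of_nonneg_left ((min_le_right _ _).trans (hi₀ i)) hε.le
  obtain ⟨_, ⟨θ, hθ, rfl⟩, hdist⟩ :=
    Metric.mem_closure_iff.1 (h.momentPoint_mem_closure hμ hν a hκ) η hη
  have hfinθ (i) : IsFiniteMeasure (θ i) := isFiniteMeasure_of_le ν (le_of_sum_eq hθ i)
  rw [Prod.dist_eq, max_lt_iff, dist_pi_lt_iff hη] at hdist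
  obtain ⟨hd1, hd2⟩ := hdist
  simp only [momentPoint, Real.dist_eq, abs_lt] at hd1 hd2
  set v : ι → ℝ := fun i => (θ i).real Set.univ with hv
  set S := ∑ i, ∫ x, ⟪x, a i⟫ ∂θ i with hS
  set r : ι → ℝ := fun i => w i - (1 - ε) * v i with hr
  have hr0 (i) : 0 ≤ r i := by
    have h1 := (hd1 i).1
    have h2 := hηw i
    change -η < w i - v i at h1
    change 0 ≤ w i - (1 - ε) * v i
    nlinarith
  have hrsum : ∑ i, r i = ε := by
    simp only [hr, Finset.sum_sub_distrib, ← Finset.mul_sum]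
    rw [hw, hv, sum_real hκ, sum_real hθ]; ring
  have hu : ∑ i, ENNReal.ofReal (r i / ε) • ν = ν := by
    rw [← Finset.sum_smul, ← ENNReal.ofReal_sum_of_nonneg fun i _ => div_nonneg (hr0 i) hε.le,
      ← Finset.sum_div, hrsum, div_self hε.ne', ENNReal.ofReal_one, one_smul]
  obtain ⟨θ', hθ', hp⟩ := decomposition_combination hν a hθ hu (s := 1 - ε) (t := ε)
    (by linarith) hε.le (by ring)
  have hfinθ' (i) : IsFiniteMeasure (θ' i) := isFiniteMeasure_of_le ν (le_of_sum_eq hθ' i)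
  rw [Prod.ext_iff] at hp
  obtain ⟨hp1, hp2⟩ := hp
  refine ⟨θ', hθ', fun i => ?_, ?_⟩
  · have := congrFun hp1 i
    simp only [momentPoint, Prod.fst_add, Prod.smul_fst, Pi.add_apply, Pi.smul_apply, smul_eq_mul,
      measureReal_ennreal_smul_apply, ENNReal.toReal_ofReal (div_nonneg (hr0 i) hε.le),
      probReal_univ, mul_one, mul_div_cancel₀ _ hε.ne'] at this
    rw [← measureReal_eq_measureReal_iff, this]
    simp [hr, hv, hw]
  · simp only [momentPoint, Prod.snd_add, Prod.smul_snd, smul_eq_mul, integral_smul_measure,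
      ENNReal.toReal_ofReal (div_nonneg (hr0 _) hε.le)] at hp2
    rw [← hS] at hp2
    have hb : -(ε * C) ≤ ε * ∑ i, r i / ε * ∫ y, ⟪y, a i⟫ ∂ν := by
      simp only [C, Finset.mul_sum, ← Finset.sum_neg_distrib]
      refine Finset.sum_le_sum fun i _ => ?_
      rw [← mul_assoc, mul_div_cancel₀ _ hε.ne']
      have h1 : r i ≤ ε := hrsum ▸ Finset.single_le_sum (fun i _ => hr0 i) (Finset.mem_univ i)
      have h2 := neg_abs_le (∫ y, ⟪y, a i⟫ ∂ν)
      have h3 := abs_nonneg (∫ y, ⟪y, a i⟫ ∂ν)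
      nlinarith [hr0 i]
    rw [hp2]
    have h1 : (1 - ε) * (T - S) ≤ (1 - ε) * η :=
      mul_le_mul_of_nonneg_left hd2.2.le (by linarith)
    have h2 : ε * T ≤ ε * |T| := mul_le_mul_of_nonneg_left (le_abs_self T) hε.le
    have h3 : 0 ≤ ε * η := by positivity
    linarith

lemma integrable_id_of_integrable_sq_norm {d : ℕ} {μ : Measure (Euc d)} [IsFiniteMeasure μ]
    (hμ : Integrable (fun x => ‖x‖ ^ 2) μ) : Integrable (fun x => x) μ := by
  have h : MemLp (fun x : Euc d => x) 2 μ :=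
    (memLp_two_iff_integrable_sq_norm measurable_id.aestronglyMeasurable).2 hμ
  exact h.integrable one_le_two

lemma ae_norm_le_one {d : ℕ} {ρ : Measure (Euc d)}
    (hρ : ρ (Metric.closedBall (0 : Euc d) 1)ᶜ = 0) : ∀ᵐ z ∂ρ, ‖z‖ ≤ 1 := by
  rw [ae_iff]
  convert hρ using 2
  ext z; simp

namespace IsCoupling

variable {d : ℕ} {μ ρ : Measure (Euc d)} {π : Measure (Euc d × Euc d)}

lemma integrable_comp_fst (h : IsCoupling μ ρ π) {f : Euc d → ℝ} (hf : Integrable f μ) :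
    Integrable (fun p => f p.1) π := by
  rw [← h.2.1] at hf
  exact hf.comp_measurable measurable_fst

lemma integrable_comp_snd (h : IsCoupling μ ρ π) {f : Euc d → ℝ} (hf : Integrable f ρ) :
    Integrable (fun p => f p.2) π := by
  rw [← h.2.2] at hf
  exact hf.comp_measurable measurable_snd

lemma integral_comp_fst (h : IsCoupling μ ρ π) {f : Euc d → ℝ} (hf : Integrable f μ) :
    ∫ p, f p.1 ∂π = ∫ x, f x ∂μ := by
  have := hf.aestronglyMeasurable
  rw [← h.2.1] at this ⊢
  exact (integral_map measurable_fst.aemeasurable this).symm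

lemma integral_comp_snd (h : IsCoupling μ ρ π) {f : Euc d → ℝ} (hf : Integrable f ρ) :
    ∫ p, f p.2 ∂π = ∫ x, f x ∂ρ := by
  have := hf.aestronglyMeasurable
  rw [← h.2.2] at this ⊢
  exact (integral_map measurable_snd.aemeasurable this).symm

lemma ae_snd (h : IsCoupling μ ρ π) {P : Euc d → Prop} (hP : ∀ᵐ z ∂ρ, P z) :
    ∀ᵐ p ∂π, P p.2 := by
  rw [← h.2.2] at hP
  exact ae_of_ae_map measurable_snd.aemeasurable hP

lemma integrable_inner (h : IsCoupling μ ρ π) (hμ : Integrable (fun x => x) μ)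
    (hρ : ρ (Metric.closedBall (0 : Euc d) 1)ᶜ = 0) :
    Integrable (fun p : Euc d × Euc d => ⟪p.1, p.2⟫) π := by
  refine (h.integrable_comp_fst hμ.norm).mono' (by fun_prop) ?_
  filter_upwards [h.ae_snd (ae_norm_le_one hρ)] with p hp
  exact (norm_inner_le_norm _ _).trans (mul_le_of_le_one_right (norm_nonneg _) hp)

lemma integral_sq_dist (h : IsCoupling μ ρ π) (hμ : Integrable (fun x => x) μ)
    (hμ2 : Integrable (fun x => ‖x‖ ^ 2) μ) (hρ2 : Integrable (fun x => ‖x‖ ^ 2) ρ)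
    (hρ : ρ (Metric.closedBall (0 : Euc d) 1)ᶜ = 0) :
    ∫ p, ‖p.1 - p.2‖ ^ 2 ∂π =
      ∫ x, ‖x‖ ^ 2 ∂μ + ∫ z, ‖z‖ ^ 2 ∂ρ - 2 * ∫ p, ⟪p.1, p.2⟫ ∂π := by
  have h1 := h.integrable_comp_fst hμ2
  have h2 := h.integrable_comp_snd hρ2
  have h3 := (h.integrable_inner hμ hρ).const_mul 2
  rw [← h.integral_comp_fst hμ2, ← h.integral_comp_snd hρ2, ← integral_const_mul,
    ← integral_add h1 h2, ← integral_sub (by exact h1.add h2) h3]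
  refine integral_congr_ae (ae_of_all _ fun p => ?_)
  simp only [norm_sub_sq_real]
  ring

lemma exists_decomposition {ι : Type*} [Fintype ι] (h : IsCoupling μ ρ π)
    (hμ : Integrable (fun x => x) μ) (hρ : ρ (Metric.closedBall (0 : Euc d) 1)ᶜ = 0)
    {A : ι → Set (Euc d)} {a : ι → Euc d} {ε : ℝ} (hA : ∀ i, MeasurableSet (A i))
    (hd : Pairwise (Function.onFun Disjoint A)) (hc : ρ (⋃ i, A i)ᶜ = 0)
    (ha : ∀ i, ∀ z ∈ A i, ‖z - a i‖ ≤ ε) :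
    ∃ κ : ι → Measure (Euc d), ∑ i, κ i = μ ∧ (∀ i, κ i Set.univ = ρ (A i)) ∧
      ∫ p, ⟪p.1, p.2⟫ ∂π ≤ ∑ i, ∫ x, ⟪x, a i⟫ ∂κ i + ε * ∫ x, ‖x‖ ∂μ := by
  have hsum : ∑ i, π.restrict (Prod.snd ⁻¹' A i) = π := by
    refine sum_restrict_eq_of_disjoint (fun i => measurable_snd (hA i))
      (fun i k hik => Disjoint.preimage _ (hd hik)) ?_
    rw [← h.2.2, Measure.map_apply measurable_snd (MeasurableSet.iUnion hA).compl] at hc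
    rwa [Set.preimage_compl, Set.preimage_iUnion] at hc
  have hκ : ∑ i, (π.restrict (Prod.snd ⁻¹' A i)).map Prod.fst = μ := by
    rw [← Measure.map_finset_sum' measurable_fst.aemeasurable, hsum, h.2.1]
  refine ⟨fun i => (π.restrict (Prod.snd ⁻¹' A i)).map Prod.fst, hκ, fun i => ?_, ?_⟩
  · rw [Measure.map_apply measurable_fst MeasurableSet.univ, Set.preimage_univ,
      Measure.restrict_apply_univ, ← h.2.2, Measure.map_apply measurable_snd (hA i)]
  · rw [integral_eq_sum_of_sum_eq hsum (h.integrable_inner hμ hρ), ← h.integral_comp_fst hμ.norm,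
      integral_eq_sum_of_sum_eq hsum (h.integrable_comp_fst hμ.norm), Finset.mul_sum,
      ← Finset.sum_add_distrib]
    refine Finset.sum_le_sum fun i _ => ?_
    have hi := h.integrable_comp_fst (integrable_inner_const hμ (a i))
    have hn := (h.integrable_comp_fst hμ.norm).const_mul ε
    rw [integral_map measurable_fst.aemeasurable (by fun_prop), ← integral_const_mul,
      ← integral_add hi.restrict hn.restrict]
    refine setIntegral_mono_on (h.integrable_inner hμ hρ).integrableOn
      (hi.add hn).integrableOn (measurable_snd (hA i)) fun p hp => ?_
    have h1 : ⟪p.1, p.2⟫ = ⟪p.1, a i⟫ + ⟪p.1, p.2 - a i⟫ := by rw [inner_sub_right]; ring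
    have h2 := real_inner_le_norm p.1 (p.2 - a i)
    have h3 := mul_le_mul_of_nonneg_left (ha i p.2 hp) (norm_nonneg p.1)
    linarith

end IsCoupling

lemma exists_coupling_of_decomposition {d : ℕ} {ι : Type*} [Fintype ι] {ν ρ : Measure (Euc d)}
    [IsProbabilityMeasure ν] [IsProbabilityMeasure ρ]
    (hν : Integrable (fun x => x) ν) (hρ : ρ (Metric.closedBall (0 : Euc d) 1)ᶜ = 0)
    {A : ι → Set (Euc d)} {a : ι → Euc d} {ε : ℝ} (hA : ∀ i, MeasurableSet (A i))
    (hd : Pairwise (Function.onFun Disjoint A)) (hc : ρ (⋃ i, A i)ᶜ = 0)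
    (hpos : ∀ i, ρ (A i) ≠ 0) (ha : ∀ i, ∀ z ∈ A i, ‖z - a i‖ ≤ ε)
    {θ : ι → Measure (Euc d)} (hθ : ∑ i, θ i = ν) (hmass : ∀ i, θ i Set.univ = ρ (A i)) :
    ∃ π, IsCoupling ν ρ π ∧
      ∑ i, ∫ y, ⟪y, a i⟫ ∂θ i - ε * ∫ y, ‖y‖ ∂ν ≤ ∫ p, ⟪p.1, p.2⟫ ∂π := by
  have hfin (i) : IsFiniteMeasure (θ i) := isFiniteMeasure_of_le ν (le_of_sum_eq hθ i)
  have hprob (i) : IsProbabilityMeasure (ProbabilityTheory.cond ρ (A i)) :=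
    ProbabilityTheory.cond_isProbabilityMeasure (hpos i)
  set π := ∑ i, (θ i).prod (ProbabilityTheory.cond ρ (A i)) with hπ
  have hfst : π.map Prod.fst = ν := by
    rw [hπ, Measure.map_finset_sum' measurable_fst.aemeasurable]
    simp [hθ]
  have hsnd : π.map Prod.snd = ρ := by
    rw [hπ, Measure.map_finset_sum' measurable_snd.aemeasurable]
    simp only [Measure.map_snd_prod, hmass]
    conv_rhs => rw [← sum_restrict_eq_of_disjoint hA hd hc]
    refine Finset.sum_congr rfl fun i _ => ?_
    rw [ProbabilityTheory.cond, smul_smul, ENNReal.mul_inv_cancel (hpos i) (measure_ne_top _ _),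
      one_smul]
  have hcoup : IsCoupling ν ρ π := by
    refine ⟨⟨?_⟩, hfst, hsnd⟩
    rw [← Set.preimage_univ (f := Prod.fst), ← Measure.map_apply measurable_fst MeasurableSet.univ,
      hfst, measure_univ]
  refine ⟨π, hcoup, ?_⟩
  rw [integral_eq_sum_of_sum_eq hπ.symm (hcoup.integrable_inner hν hρ),
    integral_eq_sum_of_sum_eq hθ hν.norm, Finset.mul_sum, ← Finset.sum_sub_distrib]
  refine Finset.sum_le_sum fun i _ => ?_
  have hi := (integrable_inner_const hν (a i)).mono_measure (le_of_sum_eq hθ i)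
  have hn := (hν.norm.mono_measure (le_of_sum_eq hθ i)).const_mul ε
  have hfun : ∫ p : Euc d × Euc d, (⟪p.1, a i⟫ - ε * ‖p.1‖)
      ∂(θ i).prod (ProbabilityTheory.cond ρ (A i)) = ∫ y, (⟪y, a i⟫ - ε * ‖y‖) ∂θ i := by
    simpa using integral_fun_fst (μ := θ i) (ν := ProbabilityTheory.cond ρ (A i))
      (fun y : Euc d => ⟪y, a i⟫ - ε * ‖y‖)
  rw [← integral_const_mul, ← integral_sub hi hn, ← hfun]
  refine integral_mono_ae ((hi.sub hn).comp_fst _)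
    ((hcoup.integrable_inner hν hρ).mono_measure (le_of_sum_eq hπ.symm i)) ?_
  have hmem : ∀ᵐ z ∂ProbabilityTheory.cond ρ (A i), z ∈ A i :=
    ProbabilityTheory.ae_cond_mem (hA i)
  filter_upwards [Measure.quasiMeasurePreserving_snd.ae hmem] with p hp
  have h1 : ⟪p.1, p.2⟫ = ⟪p.1, a i⟫ + ⟪p.1, p.2 - a i⟫ := by rw [inner_sub_right]; ring
  have h2 := (abs_le.1 (abs_real_inner_le_norm p.1 (p.2 - a i))).1
  have h3 := mul_le_mul_of_nonneg_left (ha i p.2 hp) (norm_nonneg p.1)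
  linarith

lemma exists_small_partition {d : ℕ} {ρ : Measure (Euc d)} [IsProbabilityMeasure ρ]
    (hρ : ρ (Metric.closedBall (0 : Euc d) 1)ᶜ = 0) {ε : ℝ} (hε : 0 < ε) :
    ∃ (s : Finset (Euc d)) (A : s → Set (Euc d)), (∀ i, MeasurableSet (A i)) ∧
      Pairwise (Function.onFun Disjoint A) ∧ ρ (⋃ i, A i)ᶜ = 0 ∧ (∀ i, ρ (A i) ≠ 0) ∧
      ∀ i, ∀ z ∈ A i, ‖z - i‖ ≤ ε := by
  classical
  obtain ⟨t, -, htfin, ht⟩ :=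
    (isCompact_closedBall (0 : Euc d) 1).finite_cover_balls hε
  lift t to Finset (Euc d) using htfin
  have hne : t.Nonempty := by
    obtain ⟨c, hc, -⟩ := Set.mem_iUnion₂.1 (ht (Metric.mem_closedBall_self zero_le_one))
    exact ⟨c, hc⟩
  obtain ⟨j, hj, -, hmax⟩ := exists_measurable_argmax (F := fun c x : Euc d => -dist x c)
    (fun c => by fun_prop) hne
  set B : Euc d → Set (Euc d) := fun c => Metric.closedBall 0 1 ∩ j ⁻¹' {c} with hB
  have hBm (c) : MeasurableSet (B c) := Metric.isClosed_closedBall.measurableSet.inter (hj c)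
  refine ⟨t.filter fun c => ρ (B c) ≠ 0, fun i => B i, fun i => hBm i, fun i k hik => ?_, ?_,
    fun i => (Finset.mem_filter.1 i.2).2, fun i z hz => ?_⟩
  · refine Disjoint.mono Set.inter_subset_right Set.inter_subset_right (Disjoint.preimage _ ?_)
    exact Set.disjoint_singleton.2 fun h => hik (Subtype.ext h)
  · refine measure_mono_null (t := (Metric.closedBall 0 1)ᶜ ∪
      ⋃ c ∈ t.filter fun c => ρ (B c) = 0, B c) (fun z hz => ?_)
      (measure_union_null hρ ((measure_biUnion_null_iff (Finset.countable_toSet _)).2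
        fun c hc => (Finset.mem_filter.1 hc).2))
    by_cases hz1 : z ∈ Metric.closedBall (0 : Euc d) 1
    · right
      have hzB : z ∈ B (j z) := ⟨hz1, rfl⟩
      refine Set.mem_iUnion₂.2 ⟨j z, Finset.mem_filter.2 ⟨(hmax z).1, ?_⟩, hzB⟩
      by_contra h0
      exact hz (Set.mem_iUnion.2 ⟨⟨j z, Finset.mem_filter.2 ⟨(hmax z).1, h0⟩⟩, hzB⟩)
    · exact Or.inl hz1
  · obtain ⟨c, hc, hzc⟩ := Set.mem_iUnion₂.1 (ht hz.1)
    have h1 := (hmax z).2 c hc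
    have h2 : j z = i := hz.2
    rw [← dist_eq_norm, ← h2]
    linarith [Metric.mem_ball.1 hzc]

lemma ConvexOrder.exists_coupling {d : ℕ} {μ ν ρ : Measure (Euc d)} [IsProbabilityMeasure μ]
    [IsProbabilityMeasure ν] [IsProbabilityMeasure ρ] (hμ : Integrable (fun x => x) μ)
    (hν : Integrable (fun x => x) ν) (h : ConvexOrder μ ν)
    (hρ : ρ (Metric.closedBall (0 : Euc d) 1)ᶜ = 0) {π : Measure (Euc d × Euc d)}
    (hπ : IsCoupling μ ρ π) {δ : ℝ} (hδ : 0 < δ) :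
    ∃ π', IsCoupling ν ρ π' ∧ ∫ p, ⟪p.1, p.2⟫ ∂π - δ ≤ ∫ p, ⟪p.1, p.2⟫ ∂π' := by
  set N := ∫ x, ‖x‖ ∂μ + ∫ y, ‖y‖ ∂ν with hN
  have hN0 : 0 ≤ N := add_nonneg (integral_nonneg fun _ => norm_nonneg _)
    (integral_nonneg fun _ => norm_nonneg _)
  have hε : 0 < δ / 2 / (N + 1) := by positivity
  have hεN : δ / 2 / (N + 1) * N ≤ δ / 2 := by
    rw [div_mul_eq_mul_div, div_le_iff₀ (by positivity)]
    nlinarith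
  obtain ⟨s, A, hA, hd, hc, hpos, ha⟩ := exists_small_partition hρ hε
  obtain ⟨κ, hκ, hκm, hκi⟩ := hπ.exists_decomposition hμ hρ hA hd hc ha
  obtain ⟨θ, hθ, hθm, hθi⟩ := h.exists_decomposition hμ hν (fun i : s => (i : Euc d)) hκ
    (fun i => by rw [hκm]; exact hpos i) (half_pos hδ)
  obtain ⟨π', hπ', hi⟩ := exists_coupling_of_decomposition hν hρ hA hd hc hpos ha hθ
    fun i => (hθm i).trans (hκm i)
  refine ⟨π', hπ', ?_⟩
  rw [hN, mul_add] at hεN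
  linarith

lemma integrable_sq_norm_of_closedBall {d : ℕ} {ρ : Measure (Euc d)} [IsFiniteMeasure ρ]
    (hρ : ρ (Metric.closedBall (0 : Euc d) 1)ᶜ = 0) : Integrable (fun z => ‖z‖ ^ 2) ρ := by
  refine (integrable_const (1 : ℝ)).mono' (by fun_prop) ?_
  filter_upwards [ae_norm_le_one hρ] with z hz
  rw [norm_pow, norm_norm]
  exact pow_le_one₀ (norm_nonneg _) hz

lemma isCoupling_prod {d : ℕ} (μ ρ : Measure (Euc d)) [IsProbabilityMeasure μ]
    [IsProbabilityMeasure ρ] : IsCoupling μ ρ (μ.prod ρ) :=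
  ⟨inferInstance, by simp, by simp⟩

lemma IsCoupling.W2sq_le {d : ℕ} {μ ρ : Measure (Euc d)} {π : Measure (Euc d × Euc d)}
    (h : IsCoupling μ ρ π) : W2sq μ ρ ≤ ∫ p, ‖p.1 - p.2‖ ^ 2 ∂π := by
  refine csInf_le ⟨0, ?_⟩ ⟨π, h, rfl⟩
  rintro _ ⟨π, -, rfl⟩
  exact integral_nonneg fun _ => by positivity

lemma ConvexOrder.W2sq_sub_le {d : ℕ} {μ ν ρ : Measure (Euc d)} [IsProbabilityMeasure μ]
    [IsProbabilityMeasure ν] [IsProbabilityMeasure ρ] (h : ConvexOrder μ ν)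
    (hμ2 : Integrable (fun x => ‖x‖ ^ 2) μ) (hν2 : Integrable (fun y => ‖y‖ ^ 2) ν)
    (hρ : ρ (Metric.closedBall (0 : Euc d) 1)ᶜ = 0) :
    W2sq ν ρ - W2sq μ ρ ≤ (∫ y, ‖y‖ ^ 2 ∂ν) - ∫ x, ‖x‖ ^ 2 ∂μ := by
  have hμ := integrable_id_of_integrable_sq_norm hμ2
  have hν := integrable_id_of_integrable_sq_norm hν2
  have hρ2 := integrable_sq_norm_of_closedBall hρ
  suffices W2sq ν ρ - ((∫ y, ‖y‖ ^ 2 ∂ν) - ∫ x, ‖x‖ ^ 2 ∂μ) ≤ W2sq μ ρ by linarith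
  refine le_csInf ⟨_, _, isCoupling_prod μ ρ, rfl⟩ ?_
  rintro _ ⟨π, hπ, rfl⟩
  refine le_of_forall_pos_le_add fun δ hδ => ?_
  obtain ⟨π', hπ', hle⟩ := h.exists_coupling hμ hν hρ hπ (half_pos hδ)
  have := hπ'.W2sq_le
  rw [hπ'.integral_sq_dist hν hν2 hρ2 hρ] at this
  rw [hπ.integral_sq_dist hμ hμ2 hρ2 hρ]
  linarith

/-- A finitely valued subgradient selection bounded by one tests the convex order of its
potential. -/
lemma integral_le_of_subgradient {d : ℕ} {μ ν : Measure (Euc d)} [IsProbabilityMeasure μ]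
    [IsProbabilityMeasure ν]
    (hμ2 : Integrable (fun x => ‖x‖ ^ 2) μ) (hν2 : Integrable (fun y => ‖y‖ ^ 2) ν)
    (h : ∀ ρ : Measure (Euc d), IsProbabilityMeasure ρ →
        ρ (Metric.closedBall (0 : Euc d) 1)ᶜ = 0 →
        W2sq ν ρ - W2sq μ ρ ≤ (∫ y, ‖y‖ ^ 2 ∂ν) - ∫ x, ‖x‖ ^ 2 ∂μ)
    {f : Euc d → ℝ} {T : Euc d → Euc d} (hfμ : Integrable f μ) (hfν : Integrable f ν)
    (hT : Measurable T) (hfin : (Set.range T).Finite) (hT1 : ∀ x, ‖T x‖ ≤ 1)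
    (hsub : ∀ x y, f x + ⟪y - x, T x⟫ ≤ f y) : ∫ x, f x ∂μ ≤ ∫ y, f y ∂ν := by
  have hμ := integrable_id_of_integrable_sq_norm hμ2
  have hν := integrable_id_of_integrable_sq_norm hν2
  set ρ := μ.map T with hρdef
  have hρprob : IsProbabilityMeasure ρ := Measure.isProbabilityMeasure_map hT.aemeasurable
  have hρ : ρ (Metric.closedBall (0 : Euc d) 1)ᶜ = 0 := by
    rw [hρdef, Measure.map_apply hT Metric.isClosed_closedBall.measurableSet.compl]
    convert measure_empty (μ := μ)
    ext x; simp [hT1]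
  have hρ2 := integrable_sq_norm_of_closedBall hρ
  have hgm : Measurable fun x => (x, T x) := measurable_id.prodMk hT
  have hπ₀ : IsCoupling μ ρ (μ.map fun x => (x, T x)) := by
    refine ⟨Measure.isProbabilityMeasure_map hgm.aemeasurable, ?_, ?_⟩
    · rw [Measure.map_map measurable_fst hgm]; exact Measure.map_id
    · rw [Measure.map_map measurable_snd hgm]; rfl
  have hinner : ∫ p, ⟪p.1, p.2⟫ ∂(μ.map fun x => (x, T x)) = ∫ x, ⟪x, T x⟫ ∂μ :=
    integral_map hgm.aemeasurable (by fun_prop)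
  have hinner_int : Integrable (fun x => ⟪x, T x⟫) μ :=
    (hπ₀.integrable_inner hμ hρ).comp_measurable hgm
  classical
  set β : Euc d → ℝ := fun z => if hz : ∃ x, T x = z then ⟪hz.choose, z⟫ - f hz.choose else 0
    with hβ
  have hβT (x) : β (T x) = ⟪x, T x⟫ - f x := by
    have hx : ∃ x', T x' = T x := ⟨x, rfl⟩
    simp only [hβ, dif_pos hx]
    have h1 := hsub x hx.choose
    have h2 := hsub hx.choose x
    rw [hx.choose_spec] at h2
    rw [inner_sub_left] at h1 h2
    linarith
  have hβm : Measurable β := by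
    refine measurable_of_measurable_on_compl_finite _ hfin ?_
    have : (Set.range T)ᶜ.domRestrict β = fun _ => 0 := by
      ext z
      exact dif_neg z.2
    rw [this]
    exact measurable_const
  have hβρ : Integrable β ρ := by
    rw [hρdef, integrable_map_measure hβm.aestronglyMeasurable hT.aemeasurable]
    exact (hinner_int.sub hfμ).congr (ae_of_all _ fun x => (hβT x).symm)
  have hβint : ∫ z, β z ∂ρ = ∫ x, ⟪x, T x⟫ ∂μ - ∫ x, f x ∂μ := by
    rw [hρdef, integral_map hT.aemeasurable hβm.aestronglyMeasurable, ← integral_sub hinner_int hfμ]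
    exact integral_congr_ae (ae_of_all _ hβT)
  have hyoung : ∀ᵐ z ∂ρ, ∀ y, ⟪y, z⟫ ≤ f y + β z := by
    have hmem : ∀ᵐ z ∂ρ, z ∈ Set.range T := by
      exact (ae_map_iff (p := (· ∈ Set.range T)) hT.aemeasurable hfin.measurableSet).2
        (ae_of_all _ fun x => ⟨x, rfl⟩)
    filter_upwards [hmem] with z hz y
    obtain ⟨x, rfl⟩ := hz
    have := hsub x y
    rw [inner_sub_left] at this
    rw [hβT]
    linarith
  have hW : ∫ y, ‖y‖ ^ 2 ∂ν + ∫ z, ‖z‖ ^ 2 ∂ρ - 2 * (∫ y, f y ∂ν + ∫ z, β z ∂ρ) ≤ W2sq ν ρ := by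
    refine le_csInf ⟨_, _, isCoupling_prod ν ρ, rfl⟩ ?_
    rintro _ ⟨π, hπ, rfl⟩
    rw [hπ.integral_sq_dist hν hν2 hρ2 hρ, ← hπ.integral_comp_fst hfν, ← hπ.integral_comp_snd hβρ,
      ← integral_add (hπ.integrable_comp_fst hfν) (hπ.integrable_comp_snd hβρ)]
    have : ∫ p, ⟪p.1, p.2⟫ ∂π ≤ ∫ p, (f p.1 + β p.2) ∂π :=
      integral_mono_ae (hπ.integrable_inner hν hρ)
        ((hπ.integrable_comp_fst hfν).add (hπ.integrable_comp_snd hβρ))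
        ((hπ.ae_snd hyoung).mono fun p hp => hp p.1)
    linarith
  have h1 := h ρ hρprob hρ
  have h2 := hπ₀.W2sq_le
  rw [hπ₀.integral_sq_dist hμ hμ2 hρ2 hρ, hinner] at h2
  linarith

lemma convexOrder_of_W2sq_sub_le {d : ℕ} {μ ν : Measure (Euc d)} [IsProbabilityMeasure μ]
    [IsProbabilityMeasure ν]
    (hμ2 : Integrable (fun x => ‖x‖ ^ 2) μ) (hν2 : Integrable (fun y => ‖y‖ ^ 2) ν)
    (h : ∀ ρ : Measure (Euc d), IsProbabilityMeasure ρ →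
        ρ (Metric.closedBall (0 : Euc d) 1)ᶜ = 0 →
        W2sq ν ρ - W2sq μ ρ ≤ (∫ y, ‖y‖ ^ 2 ∂ν) - ∫ x, ‖x‖ ^ 2 ∂μ) :
    ConvexOrder μ ν := by
  intro f hf hfμ hfν
  have hμ := integrable_id_of_integrable_sq_norm hμ2
  have hν := integrable_id_of_integrable_sq_norm hν2
  have hcont : Continuous f := continuousOn_univ.1 (hf.continuousOn isOpen_univ)
  obtain ⟨l, c, hle, hsup⟩ := hf.real_univ_sSup_of_nat_affine_eq hcont.lowerSemicontinuous
  set F : ℕ → Euc d → ℝ := fun i x => l i x + c i with hF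
  have hFm (i) : Measurable (F i) := by simp only [hF]; fun_prop
  have hFle (i x) : F i x ≤ f x := hle i x
  have hFint {η : Measure (Euc d)} [IsFiniteMeasure η] (hη : Integrable (fun x => x) η) (i) :
      Integrable (F i) η := ((l i).integrable_comp hη).add (integrable_const _)
  have hstep (n : ℕ) : ∃ g : Euc d → ℝ, Integrable g μ ∧ (∀ i ≤ n, ∀ x, F i x ≤ g x) ∧
      (∀ x, g x ≤ f x) ∧ ∫ x, g x ∂μ ≤ ∫ y, f y ∂ν := by
    obtain ⟨j, hj, hg, hmax⟩ := exists_measurable_argmax hFm (Finset.nonempty_range_add_one (n := n))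
    set a : ℕ → Euc d := fun i => (InnerProductSpace.toDual ℝ (Euc d)).symm (l i) with ha
    have hal (i : ℕ) (x : Euc d) : ⟪x, a i⟫ = l i x := by
      rw [real_inner_comm]; exact InnerProductSpace.toDual_symm_apply
    set L := 1 + ∑ i ∈ Finset.range (n + 1), ‖a i‖ with hL
    have hL0 : 0 < L := by positivity
    have hgμ := integrable_comp_argmax (hFint hμ) (fun x => (hmax x).1) hg
    have hgν := integrable_comp_argmax (hFint hν) (fun x => (hmax x).1) hg
    have hjm : Measurable j := measurable_to_countable' hj
    have hkey := integral_le_of_subgradient hμ2 hν2 h (f := fun x => L⁻¹ * F (j x) x)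
      (T := fun x => L⁻¹ • a (j x)) (hgμ.const_mul _) (hgν.const_mul _)
      ((Measurable.of_discrete (f := fun i => L⁻¹ • a i)).comp hjm)
      (((Finset.range (n + 1)).finite_toSet.image fun i => L⁻¹ • a i).subset (by
        rintro _ ⟨x, rfl⟩
        exact ⟨j x, (hmax x).1, rfl⟩))
      (fun x => by
        rw [norm_smul, Real.norm_of_nonneg (inv_nonneg.2 hL0.le), inv_mul_le_one₀ hL0]
        have := Finset.single_le_sum (f := fun i => ‖a i‖) (fun i _ => norm_nonneg _) (hmax x).1
        linarith)
      (fun x y => by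
        have h1 := (hmax y).2 (j x) (hmax x).1
        rw [real_inner_smul_right, hal, ← mul_add]
        refine mul_le_mul_of_nonneg_left ?_ (inv_nonneg.2 hL0.le)
        simp only [hF, map_sub] at h1 ⊢
        linarith)
    rw [integral_const_mul, integral_const_mul, mul_le_mul_iff_right₀ (inv_pos.2 hL0)] at hkey
    exact ⟨fun x => F (j x) x, hgμ,
      fun i hi x => (hmax x).2 i (Finset.mem_range.2 (Nat.lt_succ_of_le hi)),
      fun x => hFle _ x, hkey.trans (integral_mono hgν hfν fun x => hFle _ x)⟩
  choose g hgμ hFg hgf hgle using hstep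
  have hlim (x) : Filter.Tendsto (fun n => g n x) Filter.atTop (nhds (f x)) := by
    refine tendsto_order.2 ⟨fun b hb => ?_, fun b hb =>
      Filter.Eventually.of_forall fun n => (hgf n x).trans_lt hb⟩
    have hx : ⨆ i, F i x = f x := by
      rw [← hsup, iSup_apply]
      rfl
    rw [← hx] at hb
    obtain ⟨i, hi⟩ := exists_lt_of_lt_ciSup hb
    filter_upwards [Filter.eventually_ge_atTop i] with n hn
    exact hi.trans_le (hFg n i hn x)
  have hconv : Filter.Tendsto (fun n => ∫ x, g n x ∂μ) Filter.atTop (nhds (∫ x, f x ∂μ)) := by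
    refine tendsto_integral_of_dominated_convergence (fun x => ‖F 0 x‖ + ‖f x‖)
      (fun n => (hgμ n).aestronglyMeasurable) ((hFint hμ 0).norm.add hfμ.norm)
      (fun n => ae_of_all _ fun x => ?_) (ae_of_all _ hlim)
    simp only [Real.norm_eq_abs]
    refine abs_le.2 ⟨?_, ?_⟩
    · linarith [neg_abs_le (F 0 x), abs_nonneg (f x), hFg n 0 (Nat.zero_le _) x]
    · linarith [le_abs_self (f x), abs_nonneg (F 0 x), hgf n x]
  exact le_of_tendsto' hconv hgle

theorem stmt0 (d : ℕ) (hd : 1 ≤ d)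
    (μ ν : Measure (Euc d)) [IsProbabilityMeasure μ] [IsProbabilityMeasure ν]
    (hμ2 : Integrable (fun x => ‖x‖ ^ 2) μ) (hν2 : Integrable (fun y => ‖y‖ ^ 2) ν) :
    ConvexOrder μ ν ↔
      ∀ ρ : Measure (Euc d), IsProbabilityMeasure ρ →
        ρ (Metric.closedBall (0 : Euc d) 1)ᶜ = 0 →
        W2sq ν ρ - W2sq μ ρ ≤ (∫ y, ‖y‖ ^ 2 ∂ν) - ∫ x, ‖x‖ ^ 2 ∂μ :=
  ⟨fun h _ _ hρ => h.W2sq_sub_le hμ2 hν2 hρ, convexOrder_of_W2sq_sub_le hμ2 hν2⟩
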